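/- Let (W,S) be a finite Coxeter system of rank n = #S. For every subset J ⊆ S, the sum of the Möbius numbers μ_β(u,v) of the BHZ order over all pairs (u,v) with u ≤_β v, S(v) = S and S(u) = J equals (−1)^n · (Σ_{I ⊆ J} (−1)^{#I} · #W_I) · #{x ∈ W : D_R(x) = S \ J}. -/

import Mathlib

open scoped Classical

namespace ShardBHZ

variable {B : Type*} {W : Type*} [Group W] {M : CoxeterMatrix B} (cs : CoxeterSystem M W)

/-- The support `S(w)` of `w`: the set of simple reflections appearing in some
(equivalently, any) reduced word for `w`. -/
def supp (w : W) : Set B := {i | ∃ l : List B, cs.IsReduced l ∧ cs.wordProd l = w ∧ i ∈ l}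

/-- The standard parabolic subgroup `W_I` generated by the simple reflections in `I`. -/
def parab (I : Set B) : Subgroup W := Subgroup.closure (cs.simple '' I)

/-- `x` has no right descent in `I`; this characterizes the minimal length coset
representatives `W^I` of `W / W_I`. -/
def IsMinRep (I : Set B) (x : W) : Prop := ∀ i ∈ I, ¬ cs.IsRightDescent x i

/-- The BHZ order: `u ≤_β v` iff the parabolic component `v_{S(u)}` equals `u`, i.e.
`v = (v * u⁻¹) * u` is the parabolic factorization of `v` with respect to `W_{S(u)}`:
`u ∈ W_{S(u)}`, `v * u⁻¹` has no right descent in `S(u)`, and lengths add. -/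
def bhzLE (u v : W) : Prop :=
  u ∈ parab cs (supp cs u) ∧ IsMinRep cs (supp cs u) (v * u⁻¹) ∧
    cs.length v = cs.length (v * u⁻¹) + cs.length u

/-- The set `N(w)` of left inversions of `w`. -/
def invSet (w : W) : Set W := {t | cs.IsLeftInversion w t}

/-- The subgroup `G(w)` generated by `w * s * w⁻¹` for `s` a right descent of `w`. -/
def descConj (w : W) : Subgroup W :=
  Subgroup.closure {x | ∃ i, cs.IsRightDescent w i ∧ x = w * cs.simple i * w⁻¹}

/-- The shard intersection order: `u ≤_σ v` iff `N(u) ⊆ N(v)` and `G(u) ⊆ G(v)`. -/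
def shardLE (u v : W) : Prop := invSet cs u ⊆ invSet cs v ∧ descConj cs u ≤ descConj cs v

section Auxiliary

/-- The coroot functional `v ↦ 2 ⟨e i, v⟩` of the geometric representation. -/
noncomputable def coroot (M : CoxeterMatrix B) (i : B) : Module.Dual ℝ (B →₀ ℝ) :=
  Finsupp.linearCombination ℝ fun j => -2 * Real.cos (Real.pi / M i j)

lemma coroot_single (i j : B) :
    coroot M i (Finsupp.single j 1) = -2 * Real.cos (Real.pi / M i j) := by
  simp [coroot]

lemma coroot_self (i : B) : coroot M i (Finsupp.single i 1) = 2 := by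
  simp [coroot_single]

/-- A simple reflection of the geometric representation. -/
noncomputable def geomReflection (M : CoxeterMatrix B) (i : B) :
    (B →₀ ℝ) ≃ₗ[ℝ] (B →₀ ℝ) :=
  Module.reflection (coroot_self (M := M) i)

lemma geomReflection_mul_self (i : B) : geomReflection M i * geomReflection M i = 1 :=
  LinearEquiv.ext fun v => by
    rw [LinearEquiv.mul_apply, geomReflection, Module.involutive_reflection (coroot_self i) v]
    rfl

open Polynomial.Chebyshev in
lemma geomReflection_mul_pow {i j : B} (hij : i ≠ j) :
    (geomReflection M i * geomReflection M j) ^ M i j = 1 := by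
  apply LinearEquiv.toLinearMap_injective
  have hθ1 := coroot_single (M := M) i j
  have hθ2 := coroot_single (M := M) j i
  rw [M.symmetric j i] at hθ2
  have hm1 := M.off_diagonal i j hij
  set m := M i j
  obtain hm | hm | hm : m = 0 ∨ m = 2 ∨ 3 ≤ m := by omega
  · rw [hm, pow_zero]
  · rw [hm] at hθ1 hθ2 ⊢
    simp only [Nat.cast_ofNat, Real.cos_pi_div_two, mul_zero] at hθ1 hθ2
    rw [geomReflection, geomReflection, Module.reflection_mul_reflection_pow]
    norm_num [hθ1, hθ2]
    ext v
    simp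
    ring
  · have hm0 : (3 : ℝ) ≤ m := by exact_mod_cast hm
    set θ := Real.pi / m with hθ
    have hmθ : m * θ = Real.pi := by rw [hθ]; field_simp
    have ht : 2 * Real.cos (2 * θ) = coroot M i (Finsupp.single j 1) *
        coroot M j (Finsupp.single i 1) - 2 := by
      rw [hθ1, hθ2, Real.cos_two_mul]; ring
    have hpos : 0 < θ := by positivity
    have hs : Real.sin (2 * θ) ≠ 0 := by
      apply ne_of_gt
      apply Real.sin_pos_of_pos_of_lt_pi (by positivity)
      rw [← hmθ]; nlinarith
    rw [geomReflection, geomReflection, Module.reflection_mul_reflection_pow _ _ _ _ ht]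
    have hS (n : ℤ) := Polynomial.Chebyshev.S_two_mul_real_cos (2 * θ) n
    obtain ⟨k, hk | hk⟩ := Nat.even_or_odd' m
    · have h0 : (S ℝ ((k : ℤ) - 1)).eval (2 * Real.cos (2 * θ)) = 0 := by
        apply (mul_eq_zero_iff_right hs).mp
        rw [hS]
        convert Real.sin_pi using 2
        rw [← hmθ, hk]; push_cast; ring
      rw [show ((m : ℤ) - 2) / 2 = k - 1 by omega, show ((m : ℤ) - 1) / 2 = k - 1 by omega, h0]
      simp
    · have h0 : (S ℝ (k : ℤ)).eval (2 * Real.cos (2 * θ)) +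
          (S ℝ ((k : ℤ) - 1)).eval (2 * Real.cos (2 * θ)) = 0 := by
        apply (mul_eq_zero_iff_right hs).mp
        rw [add_mul, hS, hS]
        have e1 : (((k : ℤ) : ℝ) + 1) * (2 * θ) = θ + Real.pi := by
          rw [← hmθ, hk]; push_cast; ring
        have e2 : ((((k : ℤ) - 1 : ℤ) : ℝ) + 1) * (2 * θ) = Real.pi - θ := by
          rw [← hmθ, hk]; push_cast; ring
        rw [e1, e2, Real.sin_add_pi, Real.sin_pi_sub]; ring
      rw [show ((m : ℤ) - 2) / 2 = k - 1 by omega, show ((m : ℤ) - 1) / 2 = k by omega,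
        show ((m : ℤ) - 3) / 2 = k - 1 by omega, show (m : ℤ) / 2 = k by omega, h0]
      simp

lemma isLiftable_geomReflection : M.IsLiftable (geomReflection M) := by
  intro i j
  rcases eq_or_ne i j with rfl | hij
  · rw [M.diagonal, pow_one, geomReflection_mul_self]
  · exact geomReflection_mul_pow hij

lemma simple_injective : Function.Injective cs.simple := by
  intro i j hij
  have h := congrArg (cs.lift ⟨_, isLiftable_geomReflection⟩) hij
  rw [cs.lift_apply_simple, cs.lift_apply_simple] at h
  have h1 := LinearEquiv.congr_fun h (Finsupp.single i 1)
  rw [geomReflection, geomReflection, Module.reflection_apply_self, Module.reflection_apply] at h1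
  by_contra hne
  have h2 := DFunLike.congr_fun h1 i
  simp [Ne.symm hne] at h2
  norm_num at h2


/-- The indicator of equality, with values in `ZMod 2`. -/
noncomputable def eqInd {α : Type*} (a b : α) : ZMod 2 := if a = b then 1 else 0

/-- The action of a simple reflection on signed group elements. -/
noncomputable def signedConj (i : B) : Function.End (W × ZMod 2) := fun p =>
  (cs.simple i * p.1 * cs.simple i, p.2 + eqInd p.1 (cs.simple i))

lemma eqInd_congr {α : Type*} {a b c d : α} (h : a = b ↔ c = d) : eqInd a b = eqInd c d := by
  simp [eqInd, h]

lemma end_mul_apply {α : Type*} (f g : Function.End α) (a : α) : (f * g) a = f (g a) := rfl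

lemma signedConj_mul_pow (i j : B) (n : ℕ) (p : W × ZMod 2) :
    ((signedConj cs i * signedConj cs j) ^ n) p =
      ((cs.simple i * cs.simple j) ^ n * p.1 * ((cs.simple i * cs.simple j) ^ n)⁻¹,
        p.2 + ∑ l ∈ Finset.range (2 * n),
          eqInd p.1 (cs.simple j * (cs.simple i * cs.simple j) ^ l)) := by
  induction n with
  | zero => simp [Function.End.one_def]
  | succ n ih =>
    rw [pow_succ', end_mul_apply, ih, end_mul_apply]
    set c := cs.simple i * cs.simple j with hc
    have hci : c⁻¹ = cs.simple j * cs.simple i := by simp [hc]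
    have hsc (k : ℕ) : (c ^ k)⁻¹ * cs.simple j = cs.simple j * c ^ k := by
      rw [← inv_pow]
      induction k with
      | zero => simp
      | succ k ihk =>
        rw [pow_succ', mul_assoc, ihk, hci, pow_succ', hc]
        simp only [mul_assoc]
    simp only [signedConj]
    rw [show 2 * (n + 1) = 2 * n + 1 + 1 by ring, Finset.sum_range_succ, Finset.sum_range_succ]
    ext
    · simp only [pow_succ', mul_inv_rev, hci]
      simp only [hc, mul_assoc]
    · simp only [add_assoc]
      congr 3
      · apply eqInd_congr
        rw [mul_inv_eq_iff_eq_mul, ← eq_inv_mul_iff_mul_eq, ← mul_assoc, hsc, two_mul, pow_add,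
          mul_assoc]
      · apply eqInd_congr
        have e : cs.simple j * c ^ (2 * n + 1) =
            (c ^ n)⁻¹ * (cs.simple j * cs.simple i * cs.simple j) * c ^ n := by
          rw [mul_assoc (cs.simple j), ← mul_assoc _ (cs.simple j), hsc, ← hc, pow_succ, two_mul,
            pow_add, mul_assoc, mul_assoc, mul_assoc, ← pow_succ, ← pow_succ']
        rw [e]
        generalize c ^ n = d
        constructor
        · intro h
          rw [← h]
          simp [mul_assoc]
        · intro h
          rw [h]
          simp [mul_assoc]

lemma isLiftable_signedConj : M.IsLiftable (signedConj cs) := by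
  intro i j
  funext p
  rw [signedConj_mul_pow, cs.simple_mul_simple_pow, two_mul, Finset.sum_range_add]
  simp only [pow_add, cs.simple_mul_simple_pow, one_mul, inv_one, mul_one, CharTwo.add_self_eq_zero,
    add_zero]
  rfl

/-- The action of `W` on signed group elements. -/
noncomputable def signedAction : W →* Function.End (W × ZMod 2) :=
  cs.lift ⟨_, isLiftable_signedConj cs⟩

lemma signedAction_wordProd (ω : List B) (p : W × ZMod 2) :
    signedAction cs (cs.wordProd ω) p =
      (cs.wordProd ω * p.1 * (cs.wordProd ω)⁻¹, p.2 + ((cs.rightInvSeq ω).count p.1 : ℕ)) := by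
  induction ω with
  | nil => simp [Function.End.one_def]
  | cons i ω ih =>
    rw [cs.wordProd_cons, map_mul, end_mul_apply, ih, signedAction,
      cs.lift_apply_simple, signedConj, CoxeterSystem.rightInvSeq, List.count_cons]
    ext
    · simp [mul_assoc]
    · simp only [add_assoc, Nat.cast_add]
      congr 2
      simp only [eqInd, beq_iff_eq, Nat.cast_ite, Nat.cast_one, Nat.cast_zero]
      refine if_congr ?_ rfl rfl
      rw [mul_inv_eq_iff_eq_mul, mul_assoc, inv_mul_eq_iff_eq_mul, eq_comm]

lemma exchange {ω : List B} {i : B} (h : cs.IsRightDescent (cs.wordProd ω) i) :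
    ∃ j < ω.length, cs.wordProd ω * cs.simple i = cs.wordProd (ω.eraseIdx j) := by
  obtain ⟨ω', hω', hw⟩ := cs.exists_isReduced (cs.wordProd ω * cs.simple i)
  have hprod : cs.wordProd (ω'.concat i) = cs.wordProd ω := by
    rw [cs.wordProd_concat, ← hw, cs.simple_mul_simple_cancel_right]
  have hred : cs.IsReduced (ω'.concat i) := by
    rw [CoxeterSystem.IsReduced, hprod, ← cs.isRightDescent_iff.mp h, hw, hω'.eq]
    simp
  have hmem : cs.simple i ∈ cs.rightInvSeq (ω'.concat i) := by
    rw [cs.rightInvSeq_concat]; simp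
  have h1 := signedAction_wordProd cs (ω'.concat i) (cs.simple i, 0)
  rw [hprod, signedAction_wordProd, List.count_eq_one_of_mem hred.nodup_rightInvSeq hmem] at h1
  have h2 := congrArg Prod.snd h1
  have h3 : cs.simple i ∈ cs.rightInvSeq ω := by
    by_contra hn
    rw [List.count_eq_zero.mpr hn] at h2
    simp at h2
  obtain ⟨j, hj, hj'⟩ := List.mem_iff_getElem.mp h3
  refine ⟨j, by simpa using hj, ?_⟩
  rw [← cs.wordProd_mul_getD_rightInvSeq, List.getD_eq_getElem _ 1 hj, hj']

variable {cs} in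
lemma simple_mem_parab {I : Set B} {i : B} (hi : i ∈ I) : cs.simple i ∈ parab cs I :=
  Subgroup.subset_closure ⟨i, hi, rfl⟩

variable {cs} in
lemma wordProd_mem_parab {I : Set B} {ω : List B} (h : ∀ i ∈ ω, i ∈ I) :
    cs.wordProd ω ∈ parab cs I := by
  refine Subgroup.list_prod_mem _ fun x hx => ?_
  obtain ⟨i, hi, rfl⟩ := List.mem_map.mp hx
  exact simple_mem_parab (h i hi)

/-- Every word is equivalent to a reduced one using the same letters. -/
lemma exists_isReduced_subset (ω : List B) :
    ∃ ω', cs.IsReduced ω' ∧ cs.wordProd ω' = cs.wordProd ω ∧ ω' ⊆ ω := by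
  induction ω using List.reverseRecOn with
  | nil => exact ⟨[], by simp [CoxeterSystem.IsReduced], rfl, List.Subset.refl _⟩
  | append_singleton ω i ih =>
    obtain ⟨ω', hred, hprod, hsub⟩ := ih
    by_cases hd : cs.IsRightDescent (cs.wordProd ω') i
    · obtain ⟨j, hj, hjp⟩ := exchange cs hd
      refine ⟨ω'.eraseIdx j, ?_, ?_, fun k hk => ?_⟩
      · have h1 := cs.isRightDescent_iff.mp hd
        have h2 := List.length_eraseIdx_add_one hj
        rw [hjp, hred.eq] at h1
        rw [CoxeterSystem.IsReduced]
        omega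
      · rw [← hjp, hprod, cs.wordProd_append, cs.wordProd_singleton]
      · exact List.mem_append_left _ (hsub (List.mem_of_mem_eraseIdx hk))
    · refine ⟨ω' ++ [i], ?_, ?_, fun k hk => ?_⟩
      · have h1 := cs.not_isRightDescent_iff.mp hd
        rw [CoxeterSystem.IsReduced, cs.wordProd_append, cs.wordProd_singleton, h1, hred.eq]
        simp
      · rw [cs.wordProd_append, cs.wordProd_append, hprod]
      · grind

variable {cs} in
lemma exists_word_of_mem_parab {I : Set B} {w : W} (hw : w ∈ parab cs I) :
    ∃ ω, cs.wordProd ω = w ∧ ∀ i ∈ ω, i ∈ I := by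
  induction hw using Subgroup.closure_induction with
  | mem x hx =>
    obtain ⟨i, hi, rfl⟩ := hx
    exact ⟨[i], by simp, by simpa⟩
  | one => exact ⟨[], by simp, by simp⟩
  | mul x y _ _ hx hy =>
    obtain ⟨ω₁, rfl, h₁⟩ := hx
    obtain ⟨ω₂, rfl, h₂⟩ := hy
    exact ⟨ω₁ ++ ω₂, cs.wordProd_append _ _, by grind⟩
  | inv x _ hx =>
    obtain ⟨ω, rfl, h⟩ := hx
    exact ⟨ω.reverse, cs.wordProd_reverse _, by simpa⟩

variable {cs} in
lemma exists_isReduced_of_mem_parab {I : Set B} {w : W} (hw : w ∈ parab cs I) :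
    ∃ ω, cs.IsReduced ω ∧ cs.wordProd ω = w ∧ ∀ i ∈ ω, i ∈ I := by
  obtain ⟨ω, rfl, h⟩ := exists_word_of_mem_parab hw
  obtain ⟨ω', hred, hprod, hsub⟩ := exists_isReduced_subset cs ω
  exact ⟨ω', hred, hprod, fun i hi => h i (hsub hi)⟩

variable {cs} in
lemma simple_mem_parab_iff {I : Set B} {i : B} : cs.simple i ∈ parab cs I ↔ i ∈ I := by
  refine ⟨fun h => ?_, simple_mem_parab⟩
  obtain ⟨ω, hred, hprod, hω⟩ := exists_isReduced_of_mem_parab h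
  have h1 := hred.eq
  rw [hprod, cs.length_simple] at h1
  obtain ⟨k, rfl⟩ := List.length_eq_one_iff.mp h1.symm
  rw [cs.wordProd_singleton] at hprod
  rw [← simple_injective cs hprod]
  exact hω k (by simp)

variable {cs} in
lemma mem_of_isRightDescent_of_mem_parab {I : Set B} {w : W} {i : B} (h : cs.IsRightDescent w i)
    (hw : w ∈ parab cs I) : i ∈ I := by
  obtain ⟨ω, rfl, hω⟩ := exists_word_of_mem_parab hw
  obtain ⟨j, -, hj⟩ := exchange cs h
  rw [← simple_mem_parab_iff (cs := cs), ← Subgroup.mul_mem_cancel_left _ hw, hj]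
  exact wordProd_mem_parab fun k hk => hω k (List.mem_of_mem_eraseIdx hk)

variable {cs} in
lemma mem_of_isReduced_of_mem_parab {I : Set B} {ω : List B} (hred : cs.IsReduced ω)
    (hw : cs.wordProd ω ∈ parab cs I) : ∀ i ∈ ω, i ∈ I := by
  induction ω using List.reverseRecOn with
  | nil => simp
  | append_singleton ω i ih =>
    have hred' : cs.IsReduced ω := by simpa using hred.take ω.length
    have hi : i ∈ I := by
      refine mem_of_isRightDescent_of_mem_parab (w := cs.wordProd (ω ++ [i])) ?_ hw
      rw [CoxeterSystem.IsRightDescent, hred.eq, cs.wordProd_append, cs.wordProd_singleton,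
        cs.simple_mul_simple_cancel_right, hred'.eq]
      simp
    rw [cs.wordProd_append, cs.wordProd_singleton,
      Subgroup.mul_mem_cancel_right _ (simple_mem_parab hi)] at hw
    have := ih hred' hw
    grind

variable {cs} in
lemma supp_subset_iff {I : Set B} {w : W} : supp cs w ⊆ I ↔ w ∈ parab cs I := by
  constructor
  · intro h
    obtain ⟨ω, hred, rfl⟩ := cs.exists_isReduced w
    exact wordProd_mem_parab fun i hi => h ⟨ω, hred, rfl, hi⟩
  · rintro h i ⟨ω, hred, rfl, hi⟩
    exact mem_of_isReduced_of_mem_parab hred h i hi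

lemma mem_parab_supp (w : W) : w ∈ parab cs (supp cs w) := supp_subset_iff.mp subset_rfl

lemma exists_length_mul_eq_add (I : Set B) (w : W) :
    ∃ y, ∃ x ∈ parab cs I, w = y * x ∧
      ∀ z ∈ parab cs I, cs.length (y * z) = cs.length y + cs.length z := by
  have hne : ∃ n, ∃ x ∈ parab cs I, cs.length (w * x) = n := ⟨_, 1, one_mem _, rfl⟩
  obtain ⟨x, hx, hxn⟩ := Nat.find_spec hne
  have hmin (z : W) (hz : z ∈ parab cs I) : cs.length (w * x) ≤ cs.length (w * x * z) := by
    rw [hxn, mul_assoc]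
    exact Nat.find_min' hne ⟨_, mul_mem hx hz, rfl⟩
  refine ⟨w * x, x⁻¹, inv_mem hx, by simp, fun z hz => ?_⟩
  obtain ⟨ω, hred, rfl, hω⟩ := exists_isReduced_of_mem_parab hz
  obtain ⟨ω₀, hred₀, hy⟩ := cs.exists_isReduced (w * x)
  rw [hy] at hmin ⊢
  clear hz hxn hy
  induction ω using List.reverseRecOn with
  | nil => simp
  | append_singleton ω i ih =>
    have hred' : cs.IsReduced ω := by simpa using hred.take ω.length
    have hω' : ∀ k ∈ ω, k ∈ I := fun k hk => hω k (by simp [hk])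
    have ih' := ih hred' hω'
    by_cases hd : cs.IsRightDescent (cs.wordProd (ω₀ ++ ω)) i
    · exfalso
      obtain ⟨j, hj, hjp⟩ := exchange cs hd
      rw [cs.wordProd_append] at hjp
      rcases lt_or_ge j ω₀.length with hlt | hge
      · rw [List.eraseIdx_append_of_lt_length hlt, cs.wordProd_append] at hjp
        have hmem : cs.wordProd ω * cs.simple i * (cs.wordProd ω)⁻¹ ∈ parab cs I :=
          mul_mem (mul_mem (wordProd_mem_parab hω') (simple_mem_parab (hω i (by simp))))
            (inv_mem (wordProd_mem_parab hω'))
        have h1 := hmin _ hmem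
        rw [← mul_assoc, ← mul_assoc, hjp, mul_inv_cancel_right, hred₀.eq] at h1
        have h2 := cs.length_wordProd_le (ω₀.eraseIdx j)
        have h3 := List.length_eraseIdx_add_one hlt
        omega
      · rw [List.eraseIdx_append_of_length_le hge, cs.wordProd_append, mul_assoc,
          mul_left_cancel_iff] at hjp
        have h1 := hred.eq
        rw [cs.wordProd_append, cs.wordProd_singleton, hjp] at h1
        have h2 := cs.length_wordProd_le (ω.eraseIdx (j - ω₀.length))
        have h3 := List.length_eraseIdx_le ω (j - ω₀.length)
        simp at h1
        omega
    · have h1 := cs.not_isRightDescent_iff.mp hd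
      rw [hred.eq, cs.wordProd_append, cs.wordProd_singleton, ← mul_assoc, ← cs.wordProd_append,
        h1, cs.wordProd_append, ih', hred'.eq]
      simp [add_assoc]

variable {cs}

lemma IsMinRep.length_mul {I : Set B} {y x : W} (hy : IsMinRep cs I y) (hx : x ∈ parab cs I) :
    cs.length (y * x) = cs.length y + cs.length x := by
  obtain ⟨y₀, z, hz, rfl, hadd⟩ := exists_length_mul_eq_add cs I y
  rcases eq_or_ne z 1 with rfl | hne
  · simpa using hadd x hx
  · obtain ⟨i, hi⟩ := cs.exists_rightDescent_of_ne_one hne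
    have hiI := mem_of_isRightDescent_of_mem_parab hi hz
    refine absurd ?_ (hy i hiI)
    rw [CoxeterSystem.IsRightDescent, mul_assoc, hadd _ hz,
      hadd _ (mul_mem hz (simple_mem_parab hiI))]
    exact Nat.add_lt_add_left hi _

lemma exists_isMinRep_mul (cs : CoxeterSystem M W) (I : Set B) (w : W) :
    ∃ y, IsMinRep cs I y ∧ ∃ x ∈ parab cs I, y * x = w := by
  obtain ⟨y, x, hx, rfl, hadd⟩ := exists_length_mul_eq_add cs I w
  refine ⟨y, fun i hi => ?_, x, hx, rfl⟩
  rw [CoxeterSystem.IsRightDescent, hadd _ (simple_mem_parab hi)]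
  omega

lemma IsMinRep.mul_injective {I : Set B} {y x y' x' : W} (hy : IsMinRep cs I y)
    (hy' : IsMinRep cs I y') (hx : x ∈ parab cs I) (hx' : x' ∈ parab cs I)
    (h : y * x = y' * x') : y = y' ∧ x = x' := by
  have e : y' * (x' * x⁻¹) = y := by rw [← mul_assoc, ← h]; simp
  have e' : y * (x * x'⁻¹) = y' := by rw [← mul_assoc, h]; simp
  have h1 := hy'.length_mul (mul_mem hx' (inv_mem hx))
  have h2 := hy.length_mul (mul_mem hx (inv_mem hx'))
  rw [e] at h1
  rw [e'] at h2
  have h3 : x * x'⁻¹ = 1 := cs.length_eq_zero_iff.mp (by omega)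
  exact ⟨by rw [← e', h3, mul_one], mul_inv_eq_one.mp h3⟩

lemma IsMinRep.mul_iff {I K : Set B} (hIK : I ⊆ K) {y x : W} (hy : IsMinRep cs K y)
    (hx : x ∈ parab cs K) : IsMinRep cs I (y * x) ↔ IsMinRep cs I x := by
  refine forall₂_congr fun i hi => not_congr ?_
  rw [CoxeterSystem.IsRightDescent, CoxeterSystem.IsRightDescent, mul_assoc, hy.length_mul hx,
    hy.length_mul (mul_mem hx (simple_mem_parab (hIK hi)))]
  omega

lemma supp_subset_supp_mul {x u : W} (h : cs.length (x * u) = cs.length x + cs.length u) :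
    supp cs x ⊆ supp cs (x * u) ∧ supp cs u ⊆ supp cs (x * u) := by
  have key {ω₁ ω₂ : List B} (h₁ : cs.IsReduced ω₁) (h₂ : cs.IsReduced ω₂)
      (e₁ : cs.wordProd ω₁ = x) (e₂ : cs.wordProd ω₂ = u) : cs.IsReduced (ω₁ ++ ω₂) ∧
      cs.wordProd (ω₁ ++ ω₂) = x * u := by
    rw [CoxeterSystem.IsReduced, cs.wordProd_append, e₁, e₂, h, List.length_append, ← h₁.eq,
      ← h₂.eq, e₁, e₂]
    exact ⟨rfl, rfl⟩
  constructor
  · rintro i ⟨ω, hred, hprod, hi⟩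
    obtain ⟨ω₂, h₂, e₂⟩ := cs.exists_isReduced u
    obtain ⟨ha, hb⟩ := key hred h₂ hprod e₂.symm
    exact ⟨_, ha, hb, List.mem_append_left _ hi⟩
  · rintro i ⟨ω, hred, hprod, hi⟩
    obtain ⟨ω₁, h₁, e₁⟩ := cs.exists_isReduced x
    obtain ⟨ha, hb⟩ := key h₁ hred e₁.symm hprod
    exact ⟨_, ha, hb, List.mem_append_right _ hi⟩

lemma bhzLE_iff {u v : W} : bhzLE cs u v ↔ IsMinRep cs (supp cs u) (v * u⁻¹) := by
  refine ⟨fun h => h.2.1, fun h => ⟨mem_parab_supp cs u, h, ?_⟩⟩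
  simpa using h.length_mul (mem_parab_supp cs u)

lemma bhzLE.supp_subset {u v : W} (h : bhzLE cs u v) : supp cs u ⊆ supp cs v := by
  have h1 := h.2.2
  have := (supp_subset_supp_mul (cs := cs) (x := v * u⁻¹) (u := u) (by simpa using h1)).2
  simpa using this

lemma bhzLE.trans {u w v : W} (h₁ : bhzLE cs u w) (h₂ : bhzLE cs w v) : bhzLE cs u v := by
  have hmem : w * u⁻¹ ∈ parab cs (supp cs w) :=
    mul_mem (mem_parab_supp cs w) (inv_mem (supp_subset_iff.mp h₁.supp_subset))
  rw [bhzLE_iff, ← mul_one v, ← inv_mul_cancel w, ← mul_assoc v, mul_assoc,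
    IsMinRep.mul_iff h₁.supp_subset h₂.2.1 hmem]
  exact h₁.2.1

lemma IsMinRep.eq_one {x : W} (h : IsMinRep cs Set.univ x) : x = 1 := by
  by_contra hne
  obtain ⟨i, hi⟩ := cs.exists_rightDescent_of_ne_one hne
  exact h i trivial hi

lemma sum_Icc_neg_one_pow_card {α : Type*} (A J : Finset α) :
    ∑ I ∈ Finset.Icc A J, (-1 : ℤ) ^ I.card = if A = J then (-1) ^ J.card else 0 := by
  by_cases h : A ⊆ J
  · have hd {I : Finset α} (hI : I ∈ (J \ A).powerset) : Disjoint A I :=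
      Finset.disjoint_of_subset_right (Finset.mem_powerset.mp hI) Finset.disjoint_sdiff
    rw [Finset.Icc_eq_image_powerset h, Finset.sum_image]
    · have e : ∀ I ∈ (J \ A).powerset, (-1 : ℤ) ^ (A ∪ I).card = (-1) ^ A.card * (-1) ^ I.card :=
        fun I hI => by rw [Finset.card_union_of_disjoint (hd hI), pow_add]
      rw [Finset.sum_congr rfl e, ← Finset.mul_sum, Finset.sum_powerset_neg_one_pow_card]
      have hiff : J \ A = ∅ ↔ A = J := by
        rw [Finset.sdiff_eq_empty_iff_subset]
        exact ⟨h.antisymm, fun e => e.ge⟩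
      by_cases hAJ : A = J
      · simp [hAJ]
      · simp [hAJ, hiff]
    · intro I hI I' hI' e
      rw [← Finset.union_sdiff_cancel_left (hd hI), ← Finset.union_sdiff_cancel_left (hd hI')]
      exact congrArg (· \ A) e
  · rw [Finset.Icc_eq_empty h, Finset.sum_empty, if_neg fun e => h e.le]

/-- The support of an element, as a finset. -/
noncomputable def suppFinset [Fintype B] (cs : CoxeterSystem M W) (w : W) : Finset B := (supp cs w).toFinset

lemma suppFinset_subset_iff [Fintype B] {w : W} {K : Finset B} :
    suppFinset cs w ⊆ K ↔ supp cs w ⊆ (K : Set B) := by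
  simp [suppFinset]

lemma suppFinset_eq_iff [Fintype B] {w : W} {K : Finset B} :
    suppFinset cs w = K ↔ supp cs w = (K : Set B) := by
  rw [← Finset.coe_inj, suppFinset, Set.coe_toFinset]

variable [Fintype W]

lemma card_minRep_mul_card {I K : Set B} (hIK : I ⊆ K) :
    (Finset.univ.filter fun y => IsMinRep cs K y).card *
        (Finset.univ.filter fun x => x ∈ parab cs K ∧ IsMinRep cs I x).card =
      (Finset.univ.filter fun z => IsMinRep cs I z).card := by
  rw [← Finset.card_product]
  refine Finset.card_bij (fun p _ => p.1 * p.2) ?_ ?_ ?_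
  · rintro ⟨y, x⟩ h
    simp only [Finset.mem_product, Finset.mem_filter, Finset.mem_univ, true_and] at h ⊢
    exact (h.1.mul_iff hIK h.2.1).mpr h.2.2
  · rintro ⟨y, x⟩ h ⟨y', x'⟩ h' e
    simp only [Finset.mem_product, Finset.mem_filter, Finset.mem_univ, true_and] at h h' e
    obtain ⟨rfl, rfl⟩ := h.1.mul_injective h'.1 h.2.1 h'.2.1 e
    rfl
  · intro z hz
    simp only [Finset.mem_filter, Finset.mem_univ, true_and] at hz
    obtain ⟨y, hy, x, hx, rfl⟩ := exists_isMinRep_mul cs K z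
    exact ⟨(y, x), by simpa using ⟨hy, hx, (hy.mul_iff hIK hx).mp hz⟩, rfl⟩

lemma card_bhzLE_supp_subset {w : W} {K : Set B} (hw : supp cs w ⊆ K) :
    (Finset.univ.filter fun v => bhzLE cs w v ∧ supp cs v ⊆ K).card =
      (Finset.univ.filter fun x => x ∈ parab cs K ∧ IsMinRep cs (supp cs w) x).card := by
  have hwK := supp_subset_iff.mp hw
  refine Finset.card_nbij' (· * w⁻¹) (· * w) ?_ ?_ ?_ ?_
  · intro v hv
    simp only [Finset.coe_filter, Finset.mem_univ, true_and, Set.mem_ofPred_eq, bhzLE_iff,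
      supp_subset_iff] at hv ⊢
    exact ⟨mul_mem hv.2 (inv_mem hwK), hv.1⟩
  · intro x hx
    simp only [Finset.coe_filter, Finset.mem_univ, true_and, Set.mem_ofPred_eq, bhzLE_iff,
      supp_subset_iff, mul_inv_cancel_right] at hx ⊢
    exact ⟨hx.2, mul_mem hx.1 hwK⟩
  · intro v _
    simp
  · intro x _
    simp

variable [Fintype B]

/-- The signed number of elements of `W` whose right descent set is the complement of `L`. -/
noncomputable def signedDescCount (cs : CoxeterSystem M W) (L : Finset B) : ℤ :=
  (-1) ^ Fintype.card B * (-1) ^ L.card *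
    (Finset.univ.filter fun x => {i : B | cs.IsRightDescent x i} = ((L : Set B)ᶜ)).card

lemma signedDescCount_eq_sum (L : Finset B) :
    signedDescCount cs L = ∑ K : Finset B, if L ⊆ K then (-1) ^ Fintype.card B * (-1) ^ K.card *
      ((Finset.univ.filter fun x => IsMinRep cs (K : Set B) x).card : ℤ) else 0 := by
  have h1 (x : W) (K : Finset B) : IsMinRep cs (K : Set B) x ↔
      K ⊆ Finset.univ.filter fun i => ¬ cs.IsRightDescent x i := by
    simp [IsMinRep, Finset.subset_iff]
  have h2 (x : W) : {i : B | cs.IsRightDescent x i} = ((L : Set B)ᶜ) ↔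
      L = Finset.univ.filter fun i => ¬ cs.IsRightDescent x i := by
    rw [← compl_inj_iff, compl_compl, ← Finset.coe_inj, eq_comm]
    simp [Set.compl_def]
  simp only [signedDescCount, Finset.card_filter, h1, h2, Nat.cast_sum, Nat.cast_ite,
    Nat.cast_one, Nat.cast_zero, Finset.mul_sum,
    ← Finset.sum_filter (s := Finset.univ (α := Finset B))]
  rw [Finset.sum_comm]
  refine Finset.sum_congr rfl fun x _ => ?_
  have h3 := sum_Icc_neg_one_pow_card L (Finset.univ.filter fun i => ¬ cs.IsRightDescent x i)
  simp only [mul_ite, mul_one, mul_zero, ← Finset.sum_filter, Finset.filter_filter,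
    ← Finset.mul_sum]
  rw [← Finset.filter_le_le_eq_Icc] at h3
  rw [h3]
  split_ifs with h
  · rw [← h]
  · simp

lemma sum_signedDescCount (w : W) :
    (∑ v, if bhzLE cs w v then signedDescCount cs (suppFinset cs v) else 0) =
      if suppFinset cs w = Finset.univ then 1 else 0 := by
  have h1 (K : Finset B) :
      (∑ v, if bhzLE cs w v then (if suppFinset cs v ⊆ K then (-1) ^ Fintype.card B *
        (-1) ^ K.card * ((Finset.univ.filter fun x => IsMinRep cs (K : Set B) x).card : ℤ)
          else 0) else 0) =
      if suppFinset cs w ⊆ K then (-1) ^ Fintype.card B *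
        ((Finset.univ.filter fun x => IsMinRep cs (supp cs w) x).card : ℤ) * (-1) ^ K.card
          else 0 := by
    simp only [← ite_and, suppFinset_subset_iff]
    rw [← Finset.sum_filter, Finset.sum_const, nsmul_eq_mul]
    split_ifs with hw
    · rw [card_bhzLE_supp_subset hw, ← card_minRep_mul_card hw]
      push_cast
      ring
    · rw [Finset.filter_false_of_mem fun v _ h => hw (h.1.supp_subset.trans h.2)]
      simp
  simp only [signedDescCount_eq_sum, Finset.ite_sum_zero]
  rw [Finset.sum_comm]
  simp only [h1]
  have h3 := sum_Icc_neg_one_pow_card (suppFinset cs w) Finset.univ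
  rw [← Finset.filter_le_le_eq_Icc] at h3
  simp only [Finset.subset_univ, and_true] at h3
  rw [← Finset.sum_filter, ← Finset.mul_sum, h3]
  split_ifs with hw
  · have h4 : (Finset.univ.filter fun x => IsMinRep cs (supp cs w) x) = {1} := by
      rw [suppFinset_eq_iff, Finset.coe_univ] at hw
      ext x
      simp only [Finset.mem_filter, Finset.mem_univ, true_and, Finset.mem_singleton, hw]
      refine ⟨IsMinRep.eq_one, ?_⟩
      rintro rfl i -
      exact cs.not_isRightDescent_one i
    rw [h4, Finset.card_singleton, Finset.card_univ, Nat.cast_one, mul_one, ← mul_pow]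
    simp
  · simp

lemma sum_card_parab (J : Finset B) :
    ∑ I ∈ J.powerset, (-1 : ℤ) ^ I.card * Nat.card (parab cs (I : Set B)) =
      (-1) ^ J.card * (Finset.univ.filter fun u => supp cs u = (J : Set B)).card := by
  have h1 (I : Finset B) : Nat.card (parab cs (I : Set B)) =
      (Finset.univ.filter fun u => suppFinset cs u ⊆ I).card := by
    simp only [suppFinset_subset_iff, supp_subset_iff]
    rw [← Fintype.card_subtype, ← Nat.card_eq_fintype_card]
  simp only [← suppFinset_eq_iff, h1, Finset.card_filter, Nat.cast_sum, Nat.cast_ite, Nat.cast_one, Nat.cast_zero,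
    Finset.mul_sum]
  rw [Finset.sum_comm]
  refine Finset.sum_congr rfl fun u _ => ?_
  have h3 := sum_Icc_neg_one_pow_card (suppFinset cs u) J
  simp only [mul_ite, mul_one, mul_zero]
  rw [← h3, ← Finset.sum_filter]
  refine Finset.sum_congr ?_ fun _ _ => rfl
  ext I
  simp [and_comm]

lemma sum_moebius_full_supp (μβ : W → W → ℤ)
    (hβ0 : ∀ u v : W, ¬ bhzLE cs u v → μβ u v = 0)
    (hβ1 : ∀ u v : W, bhzLE cs u v →
      (∑ w : W, if bhzLE cs u w ∧ bhzLE cs w v then μβ u w else 0) = if u = v then 1 else 0)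
    (u : W) :
    (∑ v, if suppFinset cs v = Finset.univ then μβ u v else 0) =
      signedDescCount cs (suppFinset cs u) := by
  have hμ (v : W) : (∑ w, if bhzLE cs w v then μβ u w else 0) = if u = v then 1 else 0 := by
    by_cases huv : bhzLE cs u v
    · rw [← hβ1 u v huv]
      refine Finset.sum_congr rfl fun w _ => ?_
      by_cases huw : bhzLE cs u w
      · simp [huw]
      · simp [huw, hβ0 u w huw]
    · have hne : u ≠ v := by
        rintro rfl
        refine huv (bhzLE_iff.mpr fun i _ => ?_)
        rw [mul_inv_cancel]
        exact cs.not_isRightDescent_one i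
      rw [if_neg hne]
      refine Finset.sum_eq_zero fun w _ => ?_
      split_ifs with hwv
      · exact hβ0 u w fun huw => huv (huw.trans hwv)
      · rfl
  calc (∑ w, if suppFinset cs w = Finset.univ then μβ u w else 0)
      = ∑ w, μβ u w * ∑ v, if bhzLE cs w v then signedDescCount cs (suppFinset cs v) else 0 := by
        simp only [sum_signedDescCount, mul_ite, mul_one, mul_zero]
    _ = ∑ v, signedDescCount cs (suppFinset cs v) * ∑ w, if bhzLE cs w v then μβ u w else 0 := by
        simp only [Finset.mul_sum]
        rw [Finset.sum_comm]
        refine Finset.sum_congr rfl fun v _ => Finset.sum_congr rfl fun w _ => ?_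
        split_ifs <;> ring
    _ = signedDescCount cs (suppFinset cs u) := by
        simp [hμ]

end Auxiliary

/-- For every `J ⊆ S`:
`Σ_{u ≤_β v, S(v) = S, S(u) = J} μ_β(u,v)
  = (−1)^n · (Σ_{I ⊆ J} (−1)^{#I} #W_I) · #{x : D_R(x) = S \ J}`.
Here `μβ` is the Möbius function of the poset `(W, ≤_β)`, characterized by its
defining recurrence. -/
theorem bhz_mobius_sum [Finite W] [Fintype W] [Fintype B] [DecidableEq B] (μβ : W → W → ℤ)
    (hβ0 : ∀ u v : W, ¬ bhzLE cs u v → μβ u v = 0)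
    (hβ1 : ∀ u v : W, bhzLE cs u v →
      (∑ w : W, if bhzLE cs u w ∧ bhzLE cs w v then μβ u w else 0) =
        if u = v then 1 else 0)
    (J : Finset B) :
    (∑ v : W, ∑ u : W,
        if bhzLE cs u v ∧ supp cs v = (Set.univ : Set B) ∧ supp cs u = (J : Set B) then
          μβ u v else 0) =
      (-1 : ℤ) ^ (Fintype.card B) *
        (∑ I ∈ J.powerset, (-1 : ℤ) ^ I.card * Nat.card (parab cs (I : Set B))) *
        Nat.card {x : W // {i : B | cs.IsRightDescent x i} = ((J : Set B)ᶜ)} := by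
  have h1 (u : W) : (∑ v : W, if bhzLE cs u v ∧ supp cs v = (Set.univ : Set B) ∧
      supp cs u = (J : Set B) then μβ u v else 0) =
      if supp cs u = (J : Set B) then signedDescCount cs J else 0 := by
    split_ifs with hu
    · have hg := sum_moebius_full_supp μβ hβ0 hβ1 u
      rw [suppFinset_eq_iff.mpr hu] at hg
      rw [← hg]
      refine Finset.sum_congr rfl fun v _ => ?_
      by_cases huv : bhzLE cs u v
      · simp [huv, hu, suppFinset_eq_iff]
      · simp [huv, hβ0 u v huv]
    · simp [hu]
  rw [Finset.sum_comm, Finset.sum_congr rfl fun u _ => h1 u, sum_card_parab, ← Finset.sum_filter,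
    Finset.sum_const, nsmul_eq_mul, signedDescCount, Nat.card_eq_fintype_card, Fintype.card_subtype]
  ring

end ShardBHZ
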